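/- Let θ be a real antisymmetric 4 × 4 matrix. For all η, η′ in the open forward light cone Γ₊ = {x ∈ ℝ⁴ : x₀ > |x⃗|} and every Schwartz function g on ℝ⁸, the limit as t → 0⁺ of ∫_{ℝ⁴×ℝ⁴} f₂^θ(x − i t η, y − i t η′) g(x, y) dx dy exists and equals Δ₊^{(⋆2)}(g) := (2π)^{−6} ∫_{ℝ³×ℝ³} (e^{−i⟨p̃, θ k̃⟩}/(4ω(k)ω(p))) ( ∫_{ℝ⁸} g(x, y) e^{−i(ω(k) x₀ + ω(p) y₀) + i(⟨k, x⃗⟩ + ⟨p, y⃗⟩)} dx dy ) dk dp, where k̃ = (ω(k), k) and p̃ = (ω(p), p). That is, the twisted tensor product Δ₊^{(⋆2)} is the boundary value, in the sense of tempered distributions, of the analytic function f₂^θ. -/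

import Mathlib

open MeasureTheory

/-- The on-shell energy `ω(k) = √(|k|² + m²)` for `k ∈ ℝ³`. -/
noncomputable def omega (m : ℝ) (k : Fin 3 → ℝ) : ℝ :=
  Real.sqrt ((∑ i, k i ^ 2) + m ^ 2)

/-- The on-shell four-momentum `k̃ = (ω(k), k) ∈ ℝ⁴`. -/
noncomputable def onShell (m : ℝ) (k : Fin 3 → ℝ) : Fin 4 → ℝ :=
  ![omega m k, k 0, k 1, k 2]

/-- The on-shell twisting pairing `⟨p̃, θ k̃⟩ = p̃ · (θ k̃)`. -/
noncomputable def twist (m : ℝ) (θ : Matrix (Fin 4) (Fin 4) ℝ) (k p : Fin 3 → ℝ) : ℝ :=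
  ∑ i : Fin 4, onShell m p i * ∑ j : Fin 4, θ i j * onShell m k j

/-- The open forward light cone `Γ₊ = {x ∈ ℝ⁴ : x₀ > |x⃗|}`, with `ℝ⁴ = ℝ × ℝ³`. -/
noncomputable def forwardCone : Set (ℝ × (Fin 3 → ℝ)) :=
  {x | Real.sqrt (∑ i, x.2 i ^ 2) < x.1}

/-- The analytic function `f₂^θ(z, w)` whose boundary value is the twisted tensor
product `Δ₊^{(⋆2)}`. -/
noncomputable def f₂θAna (m : ℝ) (θ : Matrix (Fin 4) (Fin 4) ℝ)
    (z w : ℂ × (Fin 3 → ℂ)) : ℂ :=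
  ((((2 * Real.pi) ^ 6)⁻¹ : ℝ) : ℂ) *
    ∫ kp : (Fin 3 → ℝ) × (Fin 3 → ℝ),
      Complex.exp (-Complex.I * (omega m kp.1 : ℂ) * z.1 +
          Complex.I * ∑ i, (kp.1 i : ℂ) * z.2 i) *
        Complex.exp (-Complex.I * (omega m kp.2 : ℂ) * w.1 +
          Complex.I * ∑ i, (kp.2 i : ℂ) * w.2 i) *
        Complex.exp (-Complex.I * ((twist m θ kp.1 kp.2 : ℝ) : ℂ)) /
        (4 * (omega m kp.1 : ℂ) * (omega m kp.2 : ℂ))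

/-- The complex point `x − i t η ∈ ℂ⁴` for `x, η ∈ ℝ⁴`, `t ∈ ℝ`. -/
noncomputable def cpt (x η : ℝ × (Fin 3 → ℝ)) (t : ℝ) : ℂ × (Fin 3 → ℂ) :=
  ((x.1 : ℂ) - Complex.I * (t : ℂ) * (η.1 : ℂ),
    fun i => (x.2 i : ℂ) - Complex.I * (t : ℂ) * (η.2 i : ℂ))

/-- The twisted tensor product `Δ₊^{(⋆2)}` of two-point functions, as a functional on
functions on `ℝ⁸ = ℝ⁴ × ℝ⁴`. -/
noncomputable def twoPointTw (m : ℝ) (θ : Matrix (Fin 4) (Fin 4) ℝ)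
    (g : ((ℝ × (Fin 3 → ℝ)) × (ℝ × (Fin 3 → ℝ))) → ℂ) : ℂ :=
  ((((2 * Real.pi) ^ 6)⁻¹ : ℝ) : ℂ) *
    ∫ kp : (Fin 3 → ℝ) × (Fin 3 → ℝ),
      Complex.exp (-Complex.I * ((twist m θ kp.1 kp.2 : ℝ) : ℂ)) *
        (((4 * omega m kp.1 * omega m kp.2)⁻¹ : ℝ) : ℂ) *
        ∫ xy : (ℝ × (Fin 3 → ℝ)) × (ℝ × (Fin 3 → ℝ)),
          g xy * Complex.exp
            (-Complex.I * ((omega m kp.1 : ℂ) * (xy.1.1 : ℂ) + (omega m kp.2 : ℂ) * (xy.2.1 : ℂ)) +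
              Complex.I * ((∑ i, (kp.1 i : ℂ) * (xy.1.2 i : ℂ)) +
                ∑ i, (kp.2 i : ℂ) * (xy.2.2 i : ℂ)))

theorem isAddHaarMeasure_volume_prod {E F : Type*} [NormedAddCommGroup E] [MeasureSpace E]
    [BorelSpace E] [SecondCountableTopology E] [NormedAddCommGroup F] [MeasureSpace F]
    [BorelSpace F] [SecondCountableTopology F] [SigmaFinite (volume : Measure E)]
    [SigmaFinite (volume : Measure F)] [(volume : Measure E).IsAddHaarMeasure]
    [(volume : Measure F).IsAddHaarMeasure] : (volume : Measure (E × F)).IsAddHaarMeasure :=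
  inferInstanceAs ((volume : Measure E).prod (volume : Measure F)).IsAddHaarMeasure

instance : (volume : Measure ((Fin 3 → ℝ) × (Fin 3 → ℝ))).IsAddHaarMeasure := by
  apply isAddHaarMeasure_volume_prod

instance : (volume : Measure (ℝ × (Fin 3 → ℝ))).IsAddHaarMeasure := by
  apply isAddHaarMeasure_volume_prod

instance : (volume : Measure ((ℝ × (Fin 3 → ℝ)) × (ℝ × (Fin 3 → ℝ)))).IsAddHaarMeasure :=
  isAddHaarMeasure_volume_prod (E := ℝ × (Fin 3 → ℝ)) (F := ℝ × (Fin 3 → ℝ))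

/-- The oscillatory integral of a Schwartz function against `exp (i φ)` decays faster than any
power of `φ v`, uniformly in the linear phase `φ`. -/
theorem SchwartzMap.exists_pow_mul_norm_integral_exp_le {V : Type*} [NormedAddCommGroup V]
    [NormedSpace ℝ V] [FiniteDimensional ℝ V] [MeasurableSpace V] [BorelSpace V]
    (μ : Measure V) [μ.IsAddHaarMeasure] (g : SchwartzMap V ℂ) (n : ℕ) (v : V) :
    ∃ C, ∀ φ : V →L[ℝ] ℝ,
      |φ v| ^ n * ‖∫ x, g x * Complex.exp (Complex.I * (φ x : ℂ)) ∂μ‖ ≤ C := by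
  let L : V →L[ℝ] (V →L[ℝ] ℝ) →L[ℝ] ℝ := (ContinuousLinearMap.id ℝ (V →L[ℝ] ℝ)).flip
  have hpi : 0 < 2 * Real.pi := by positivity
  refine ⟨(2 * Real.pi) ^ n * (‖v‖ ^ n * (2 * (0 : ℕ) + 2) ^ n *
    ∑ p ∈ Finset.range (0 + 1) ×ˢ Finset.range (n + 1),
      ∫ v, ‖v‖ ^ p.1 * ‖iteratedFDeriv ℝ p.2 g v‖ ∂μ), fun φ => ?_⟩
  have h := VectorFourier.pow_mul_norm_iteratedFDeriv_fourierIntegral_le L (μ := μ)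
    (K := ⊤) (N := ⊤) (g.smooth ⊤) (fun k n _ _ => g.integrable_pow_mul_iteratedFDeriv μ k n)
    (k := 0) (n := n) le_top le_top v (-(2 * Real.pi)⁻¹ • φ)
  rw [norm_iteratedFDeriv_zero, pow_zero, mul_one] at h
  have hF : VectorFourier.fourierIntegral Real.fourierChar μ L.toLinearMap₁₂ g
      (-(2 * Real.pi)⁻¹ • φ) = ∫ x, g x * Complex.exp (Complex.I * (φ x : ℂ)) ∂μ := by
    refine integral_congr_ae (.of_forall fun x => ?_)
    have hx : 2 * Real.pi * (-L x (-(2 * Real.pi)⁻¹ • φ)) = φ x := by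
      simp only [L, ContinuousLinearMap.flip_apply, ContinuousLinearMap.id_apply,
        smul_apply, smul_eq_mul]
      field_simp
    simp only [ContinuousLinearMap.toLinearMap₁₂_apply_apply_apply, Circle.smul_def,
      Real.fourierChar_apply, hx, smul_eq_mul]
    rw [mul_comm, mul_comm Complex.I]
  have hv : |φ v| ^ n = (2 * Real.pi) ^ n * |L v (-(2 * Real.pi)⁻¹ • φ)| ^ n := by
    rw [← mul_pow, ← abs_of_pos hpi, ← abs_mul, abs_of_pos hpi]
    simp only [L, ContinuousLinearMap.flip_apply, ContinuousLinearMap.id_apply,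
      smul_apply, smul_eq_mul]
    rw [← abs_neg]
    congr 2
    field_simp
  rw [hF] at h
  rw [hv, mul_assoc]
  exact mul_le_mul_of_nonneg_left h (by positivity)

theorem integrable_exp_neg_mul_norm {E : Type*} [NormedAddCommGroup E] [NormedSpace ℝ E]
    [FiniteDimensional ℝ E] [MeasurableSpace E] [BorelSpace E] (μ : Measure E)
    [μ.IsAddHaarMeasure] {a : ℝ} (ha : 0 < a) :
    Integrable (fun x : E => Real.exp (-(a * ‖x‖))) μ := by
  set n := Module.finrank ℝ E + 1 with hn
  have hint := integrable_one_add_norm (μ := μ) (E := E) (r := (n : ℝ)) (by simp [hn])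
  refine (hint.const_mul (Real.exp a * (n.factorial / a ^ n))).mono'
    (by fun_prop : Continuous _).aestronglyMeasurable (.of_forall fun x => ?_)
  have hx : 0 < 1 + ‖x‖ := by positivity
  have h := Real.pow_div_factorial_le_exp (x := a * (1 + ‖x‖)) (by positivity) n
  rw [Real.norm_of_nonneg (Real.exp_pos _).le, Real.rpow_neg hx.le, Real.rpow_natCast]
  have e : Real.exp (-(a * ‖x‖)) = Real.exp a * (Real.exp (a * (1 + ‖x‖)))⁻¹ := by
    rw [← Real.exp_neg, ← Real.exp_add]
    ring_nf
  rw [e, mul_assoc]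
  refine mul_le_mul_of_nonneg_left ?_ (Real.exp_pos _).le
  calc (Real.exp (a * (1 + ‖x‖)))⁻¹ ≤ ((a * (1 + ‖x‖)) ^ n / n.factorial)⁻¹ := by
        gcongr
    _ = n.factorial / a ^ n * ((1 + ‖x‖) ^ n)⁻¹ := by
        rw [mul_pow]
        field_simp

theorem continuous_omega (m : ℝ) : Continuous (omega m) := by
  unfold omega
  fun_prop

theorem le_omega (m : ℝ) (k : Fin 3 → ℝ) : m ≤ omega m k :=
  Real.le_sqrt_of_sq_le (le_add_of_nonneg_left (Finset.sum_nonneg fun i _ => sq_nonneg (k i)))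

theorem sqrt_sum_sq_le_omega (m : ℝ) (k : Fin 3 → ℝ) : √(∑ i, k i ^ 2) ≤ omega m k :=
  Real.sqrt_le_sqrt (le_add_of_nonneg_right (sq_nonneg m))

theorem norm_le_omega (m : ℝ) (k : Fin 3 → ℝ) : ‖k‖ ≤ omega m k := by
  refine (pi_norm_le_iff_of_nonneg (Real.sqrt_nonneg _)).2 fun i => ?_
  refine le_trans (Real.abs_le_sqrt ?_) (sqrt_sum_sq_le_omega m k)
  exact Finset.single_le_sum (f := fun i => k i ^ 2) (fun j _ => sq_nonneg (k j))
    (Finset.mem_univ i)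

theorem continuous_onShell (m : ℝ) : Continuous (onShell m) := by
  have := continuous_omega m
  refine continuous_pi fun i => ?_
  fin_cases i <;> simp [onShell] <;> fun_prop

theorem continuous_twist (m : ℝ) (θ : Matrix (Fin 4) (Fin 4) ℝ) :
    Continuous fun kp : (Fin 3 → ℝ) × (Fin 3 → ℝ) => twist m θ kp.1 kp.2 := by
  have := continuous_onShell m
  unfold twist
  fun_prop

/-- The rate of exponential decay in `k` of the plane wave `e^{-iω(k) z₀ + i⟨k, z⃗⟩}` along the
imaginary direction `-η`. -/
noncomputable def decayRate (m : ℝ) (η : ℝ × (Fin 3 → ℝ)) (k : Fin 3 → ℝ) : ℝ :=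
  omega m k * η.1 - ∑ i, k i * η.2 i

theorem continuous_decayRate (m : ℝ) (η : ℝ × (Fin 3 → ℝ)) : Continuous (decayRate m η) := by
  have := continuous_omega m
  unfold decayRate
  fun_prop

theorem exists_mul_norm_le_decayRate (m : ℝ) {η : ℝ × (Fin 3 → ℝ)} (hη : η ∈ forwardCone) :
    ∃ δ > 0, ∀ k, δ * ‖k‖ ≤ decayRate m η k := by
  have hη : √(∑ i, η.2 i ^ 2) < η.1 := hη
  refine ⟨η.1 - √(∑ i, η.2 i ^ 2), sub_pos.2 hη, fun k => ?_⟩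
  have hcs := Real.sum_mul_le_sqrt_mul_sqrt Finset.univ k η.2
  have h₁ := mul_le_mul_of_nonneg_right (sqrt_sum_sq_le_omega m k)
    (Real.sqrt_nonneg (∑ i, η.2 i ^ 2))
  have h₂ := mul_le_mul_of_nonneg_left (norm_le_omega m k) (sub_pos.2 hη).le
  unfold decayRate
  linarith

/-- The twisted on-shell density `e^{-i⟨p̃, θ k̃⟩} / (4ω(k)ω(p))`. -/
noncomputable def twistedDensity (m : ℝ) (θ : Matrix (Fin 4) (Fin 4) ℝ)
    (kp : (Fin 3 → ℝ) × (Fin 3 → ℝ)) : ℂ :=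
  Complex.exp (-Complex.I * ((twist m θ kp.1 kp.2 : ℝ) : ℂ)) *
    (((4 * omega m kp.1 * omega m kp.2)⁻¹ : ℝ) : ℂ)

theorem continuous_twistedDensity {m : ℝ} (hm : 0 < m) (θ : Matrix (Fin 4) (Fin 4) ℝ) :
    Continuous (twistedDensity m θ) := by
  have h₁ := continuous_twist m θ
  have h₂ := continuous_omega m
  have h₃ : Continuous fun kp : (Fin 3 → ℝ) × (Fin 3 → ℝ) =>
      (4 * omega m kp.1 * omega m kp.2)⁻¹ := by
    refine Continuous.inv₀ (by fun_prop) fun kp => ?_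
    have := hm.trans_le (le_omega m kp.1)
    have := hm.trans_le (le_omega m kp.2)
    positivity
  unfold twistedDensity
  fun_prop

theorem norm_twistedDensity_le {m : ℝ} (hm : 0 < m) (θ : Matrix (Fin 4) (Fin 4) ℝ)
    (kp : (Fin 3 → ℝ) × (Fin 3 → ℝ)) : ‖twistedDensity m θ kp‖ ≤ (4 * m * m)⁻¹ := by
  have h₁ := le_omega m kp.1
  have h₂ := le_omega m kp.2
  have h₃ := hm.trans_le h₁
  have h₄ := hm.trans_le h₂
  have : ‖Complex.exp (-Complex.I * ((twist m θ kp.1 kp.2 : ℝ) : ℂ))‖ = 1 := by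
    simp [Complex.norm_exp]
  rw [twistedDensity, norm_mul, this, one_mul, Complex.norm_real,
    Real.norm_of_nonneg (by positivity)]
  gcongr

/-- The phase `-(ω(k)x₀ + ω(p)y₀) + ⟨k, x⃗⟩ + ⟨p, y⃗⟩` as a linear functional of `(x, y)`. -/
noncomputable def onShellPhase (m : ℝ) (kp : (Fin 3 → ℝ) × (Fin 3 → ℝ)) :
    (ℝ × (Fin 3 → ℝ)) × (ℝ × (Fin 3 → ℝ)) →L[ℝ] ℝ :=
  LinearMap.toContinuousLinearMap
    { toFun := fun xy => -(omega m kp.1 * xy.1.1 + omega m kp.2 * xy.2.1) +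
        ((∑ i, kp.1 i * xy.1.2 i) + ∑ i, kp.2 i * xy.2.2 i)
      map_add' := fun x y => by
        simp only [Prod.fst_add, Prod.snd_add, Pi.add_apply, mul_add, Finset.sum_add_distrib]
        ring
      map_smul' := fun c x => by
        simp only [Prod.smul_fst, Prod.smul_snd, Pi.smul_apply, smul_eq_mul, RingHom.id_apply,
          Fin.sum_univ_three]
        ring }

theorem onShellPhase_apply (m : ℝ) (kp : (Fin 3 → ℝ) × (Fin 3 → ℝ))
    (xy : (ℝ × (Fin 3 → ℝ)) × (ℝ × (Fin 3 → ℝ))) :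
    onShellPhase m kp xy = -(omega m kp.1 * xy.1.1 + omega m kp.2 * xy.2.1) +
        ((∑ i, kp.1 i * xy.1.2 i) + ∑ i, kp.2 i * xy.2.2 i) := rfl

theorem continuous_onShellPhase_uncurry (m : ℝ) :
    Continuous fun q : ((Fin 3 → ℝ) × (Fin 3 → ℝ)) ×
      ((ℝ × (Fin 3 → ℝ)) × (ℝ × (Fin 3 → ℝ))) => onShellPhase m q.1 q.2 := by
  have := continuous_omega m
  simp only [onShellPhase_apply]
  fun_prop

/-- The Fourier transform of a function on `ℝ⁸`, restricted to the two mass shells. -/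
noncomputable def onShellFourier (m : ℝ) (g : ((ℝ × (Fin 3 → ℝ)) × (ℝ × (Fin 3 → ℝ))) → ℂ)
    (kp : (Fin 3 → ℝ) × (Fin 3 → ℝ)) : ℂ :=
  ∫ xy, g xy * Complex.exp (Complex.I * (onShellPhase m kp xy : ℂ))

theorem norm_exp_I_mul_ofReal_eq_one (x : ℝ) : ‖Complex.exp (Complex.I * (x : ℂ))‖ = 1 := by
  rw [mul_comm, Complex.norm_exp_ofReal_mul_I]

theorem continuous_onShellFourier (m : ℝ)
    (g : SchwartzMap ((ℝ × (Fin 3 → ℝ)) × (ℝ × (Fin 3 → ℝ))) ℂ) :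
    Continuous (onShellFourier m g) := by
  have hc (xy) : Continuous fun kp : (Fin 3 → ℝ) × (Fin 3 → ℝ) => onShellPhase m kp xy := by
    have := continuous_omega m
    simp only [onShellPhase_apply]
    fun_prop
  refine continuous_of_dominated (bound := fun xy => ‖g xy‖) (fun kp => ?_) (fun kp => ?_)
    g.integrable.norm (.of_forall fun xy => ?_)
  · have := g.continuous
    exact (by fun_prop : Continuous _).aestronglyMeasurable
  · refine .of_forall fun xy => ?_
    rw [norm_mul, norm_exp_I_mul_ofReal_eq_one, mul_one]
  · have := hc xy
    fun_prop

theorem exists_norm_pow_mul_norm_onShellFourier_le (m : ℝ)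
    (g : SchwartzMap ((ℝ × (Fin 3 → ℝ)) × (ℝ × (Fin 3 → ℝ))) ℂ) (n : ℕ) :
    ∃ C, ∀ kp, ‖kp‖ ^ n * ‖onShellFourier m g kp‖ ≤ C := by
  have key := g.exists_pow_mul_norm_integral_exp_le volume n
  choose C hC using key
  let e₁ : Fin 3 → (ℝ × (Fin 3 → ℝ)) × (ℝ × (Fin 3 → ℝ)) := fun i => ((0, Pi.single i 1), 0)
  let e₂ : Fin 3 → (ℝ × (Fin 3 → ℝ)) × (ℝ × (Fin 3 → ℝ)) := fun i => (0, (0, Pi.single i 1))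
  have h₁ (kp i) : onShellPhase m kp (e₁ i) = kp.1 i := by
    simp [onShellPhase_apply, e₁, Pi.single_apply]
  have h₂ (kp i) : onShellPhase m kp (e₂ i) = kp.2 i := by
    simp [onShellPhase_apply, e₂, Pi.single_apply]
  have hC₀ (v) : 0 ≤ C v := le_trans (by positivity) (hC v 0)
  refine ⟨∑ i, C (e₁ i) + ∑ i, C (e₂ i), fun kp => ?_⟩
  have hn₁ : 0 ≤ ∑ i, C (e₁ i) := Finset.sum_nonneg fun i _ => hC₀ _
  have hn₂ : 0 ≤ ∑ i, C (e₂ i) := Finset.sum_nonneg fun i _ => hC₀ _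
  have hsup (k : Fin 3 → ℝ) : ∃ i, ‖k i‖ = ‖k‖ := by
    obtain ⟨i, hi⟩ := Finite.exists_max fun i => ‖k i‖
    exact ⟨i, (norm_le_pi_norm k i).antisymm ((pi_norm_le_iff_of_nonneg (norm_nonneg _)).2 hi)⟩
  obtain ⟨i, hi⟩ := hsup kp.1
  obtain ⟨j, hj⟩ := hsup kp.2
  rcases max_choice ‖kp.1‖ ‖kp.2‖ with h | h
  · rw [Prod.norm_def, h, ← hi, Real.norm_eq_abs, ← h₁]
    have := Finset.single_le_sum (f := fun i => C (e₁ i)) (fun i _ => hC₀ _) (Finset.mem_univ i)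
    exact (hC (e₁ i) (onShellPhase m kp)).trans (by linarith)
  · rw [Prod.norm_def, h, ← hj, Real.norm_eq_abs, ← h₂]
    have := Finset.single_le_sum (f := fun i => C (e₂ i)) (fun i _ => hC₀ _) (Finset.mem_univ j)
    exact (hC (e₂ j) (onShellPhase m kp)).trans (by linarith)

theorem integrable_onShellFourier (m : ℝ)
    (g : SchwartzMap ((ℝ × (Fin 3 → ℝ)) × (ℝ × (Fin 3 → ℝ))) ℂ) :
    Integrable (onShellFourier m g) := by
  let n := (volume : Measure ((Fin 3 → ℝ) × (Fin 3 → ℝ))).integrablePower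
  obtain ⟨C, hC⟩ := exists_norm_pow_mul_norm_onShellFourier_le m g 0
  obtain ⟨C', hC'⟩ := exists_norm_pow_mul_norm_onShellFourier_le m g (0 + n)
  have hm := (continuous_onShellFourier m g).aestronglyMeasurable (μ := volume)
  refine (integrable_norm_iff hm).1 ?_
  simpa using integrable_of_le_of_pow_mul_le (k := 0) (by simpa using hC) hC' hm

theorem twoPointTw_eq (m : ℝ) (θ : Matrix (Fin 4) (Fin 4) ℝ)
    (g : ((ℝ × (Fin 3 → ℝ)) × (ℝ × (Fin 3 → ℝ))) → ℂ) :
    twoPointTw m θ g = ((((2 * Real.pi) ^ 6)⁻¹ : ℝ) : ℂ) *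
      ∫ kp, twistedDensity m θ kp * onShellFourier m g kp := by
  unfold twoPointTw
  congr 1
  refine integral_congr_ae (.of_forall fun kp => ?_)
  simp only [twistedDensity, onShellFourier, onShellPhase_apply]
  congr 2
  ext xy
  congr 2
  push_cast
  ring

theorem f₂θAna_cpt_eq (m : ℝ) (θ : Matrix (Fin 4) (Fin 4) ℝ) (η η' : ℝ × (Fin 3 → ℝ)) (t : ℝ)
    (xy : (ℝ × (Fin 3 → ℝ)) × (ℝ × (Fin 3 → ℝ))) :
    f₂θAna m θ (cpt xy.1 η t) (cpt xy.2 η' t) = ((((2 * Real.pi) ^ 6)⁻¹ : ℝ) : ℂ) *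
      ∫ kp : (Fin 3 → ℝ) × (Fin 3 → ℝ),
        (Real.exp (-(t * (decayRate m η kp.1 + decayRate m η' kp.2))) : ℂ) *
          (twistedDensity m θ kp * Complex.exp (Complex.I * (onShellPhase m kp xy : ℂ))) := by
  unfold f₂θAna
  congr 1
  refine integral_congr_ae (.of_forall fun kp => ?_)
  have hexp : Complex.exp (-Complex.I * (omega m kp.1 : ℂ) * (cpt xy.1 η t).1 +
          Complex.I * ∑ i, (kp.1 i : ℂ) * (cpt xy.1 η t).2 i) *
        Complex.exp (-Complex.I * (omega m kp.2 : ℂ) * (cpt xy.2 η' t).1 +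
          Complex.I * ∑ i, (kp.2 i : ℂ) * (cpt xy.2 η' t).2 i) =
      (Real.exp (-(t * (decayRate m η kp.1 + decayRate m η' kp.2))) : ℂ) *
        Complex.exp (Complex.I * (onShellPhase m kp xy : ℂ)) := by
    rw [← Complex.exp_add, Complex.ofReal_exp, ← Complex.exp_add]
    congr 1
    simp only [cpt, onShellPhase_apply, decayRate, Fin.sum_univ_three]
    push_cast
    linear_combination (t * (omega m kp.1 * η.1 + omega m kp.2 * η'.1 -
      (kp.1 0 * η.2 0 + kp.1 1 * η.2 1 + kp.1 2 * η.2 2) -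
      (kp.2 0 * η'.2 0 + kp.2 1 * η'.2 1 + kp.2 2 * η'.2 2)) : ℂ) * Complex.I_sq
  simp only [hexp, twistedDensity, div_eq_mul_inv]
  push_cast
  ring

/-- Fubini's theorem for the pairing of `f₂^θ`, regularized in the directions `η`, `η'`, with a
test function. -/
theorem integral_f₂θAna_cpt_mul {m : ℝ} (hm : 0 < m) (θ : Matrix (Fin 4) (Fin 4) ℝ)
    {η η' : ℝ × (Fin 3 → ℝ)} (hη : η ∈ forwardCone) (hη' : η' ∈ forwardCone)
    (g : SchwartzMap ((ℝ × (Fin 3 → ℝ)) × (ℝ × (Fin 3 → ℝ))) ℂ) {t : ℝ} (ht : 0 < t) :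
    ∫ xy : (ℝ × (Fin 3 → ℝ)) × (ℝ × (Fin 3 → ℝ)),
      f₂θAna m θ (cpt xy.1 η t) (cpt xy.2 η' t) * g xy =
    ((((2 * Real.pi) ^ 6)⁻¹ : ℝ) : ℂ) * ∫ kp : (Fin 3 → ℝ) × (Fin 3 → ℝ),
      (Real.exp (-(t * (decayRate m η kp.1 + decayRate m η' kp.2))) : ℂ) *
        (twistedDensity m θ kp * onShellFourier m g kp) := by
  have hcD := continuous_twistedDensity hm θ
  have hcη := continuous_decayRate m η
  have hcη' := continuous_decayRate m η'
  have hcφ := continuous_onShellPhase_uncurry m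
  let A : (Fin 3 → ℝ) × (Fin 3 → ℝ) → ℂ := fun kp =>
    (Real.exp (-(t * (decayRate m η kp.1 + decayRate m η' kp.2))) : ℂ) * twistedDensity m θ kp
  have hcA : Continuous A := by fun_prop
  have hA : Integrable A := by
    obtain ⟨δ, hδ, h⟩ := exists_mul_norm_le_decayRate m hη
    obtain ⟨δ', hδ', h'⟩ := exists_mul_norm_le_decayRate m hη'
    have hmin : 0 < min δ δ' := lt_min hδ hδ'
    refine ((integrable_exp_neg_mul_norm (E := (Fin 3 → ℝ) × (Fin 3 → ℝ)) volume
      (mul_pos ht hmin)).mul_const (4 * m * m)⁻¹).mono' hcA.aestronglyMeasurable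
      (.of_forall fun kp => ?_)
    rw [norm_mul, Complex.norm_real, Real.norm_of_nonneg (Real.exp_pos _).le]
    refine mul_le_mul (Real.exp_le_exp.2 (neg_le_neg ?_)) (norm_twistedDensity_le hm θ kp)
      (norm_nonneg _) (Real.exp_pos _).le
    rw [mul_assoc]
    refine mul_le_mul_of_nonneg_left ?_ ht.le
    calc min δ δ' * ‖kp‖ ≤ min δ δ' * (‖kp.1‖ + ‖kp.2‖) := by
          gcongr
          exact max_le_add_of_nonneg (norm_nonneg _) (norm_nonneg _)
      _ ≤ δ * ‖kp.1‖ + δ' * ‖kp.2‖ := by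
          rw [mul_add]
          gcongr
          exacts [min_le_left _ _, min_le_right _ _]
      _ ≤ _ := add_le_add (h _) (h' _)
  have hint : Integrable (Function.uncurry fun (kp : (Fin 3 → ℝ) × (Fin 3 → ℝ))
      (xy : (ℝ × (Fin 3 → ℝ)) × (ℝ × (Fin 3 → ℝ))) =>
      Complex.exp (Complex.I * (onShellPhase m kp xy : ℂ)) * (A kp * g xy))
      (volume.prod volume) := by
    refine (hA.mul_prod g.integrable).bdd_mul (c := 1)
      (by fun_prop : Continuous _).aestronglyMeasurable (.of_forall fun q => ?_)
    exact (norm_exp_I_mul_ofReal_eq_one _).le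
  have hswap := integral_integral_swap hint
  calc _ = ((((2 * Real.pi) ^ 6)⁻¹ : ℝ) : ℂ) *
        ∫ xy, ∫ kp, Complex.exp (Complex.I * (onShellPhase m kp xy : ℂ)) * (A kp * g xy) := by
        rw [← integral_const_mul]
        congr 1 with xy
        rw [f₂θAna_cpt_eq, mul_assoc, ← integral_mul_const]
        congr 2 with kp
        simp only [A]
        ring
    _ = _ := by
        rw [← hswap]
        congr 2 with kp
        rw [onShellFourier, ← mul_assoc, ← integral_const_mul]
        congr 1 with xy
        simp only [A]
        ring


/-- The twisted tensor product `Δ₊^{(⋆2)}` is the boundary value of the analytic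
function `f₂^θ` in the sense of tempered distributions: for all `η, η′` in the open
forward light cone and every Schwartz `g` on `ℝ⁸`,
`∫∫ f₂^θ(x − itη, y − itη′) g(x,y) dx dy → Δ₊^{(⋆2)}(g)` as `t → 0⁺`. -/
theorem twoPointTw_boundary_value (m : ℝ) (hm : 0 < m)
    (θ : Matrix (Fin 4) (Fin 4) ℝ) (hθ : θ.transpose = -θ)
    (η η' : ℝ × (Fin 3 → ℝ)) (hη : η ∈ forwardCone) (hη' : η' ∈ forwardCone)
    (g : SchwartzMap ((ℝ × (Fin 3 → ℝ)) × (ℝ × (Fin 3 → ℝ))) ℂ) :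
    Filter.Tendsto (fun t : ℝ =>
        ∫ xy : (ℝ × (Fin 3 → ℝ)) × (ℝ × (Fin 3 → ℝ)),
          f₂θAna m θ (cpt xy.1 η t) (cpt xy.2 η' t) * g xy)
      (nhdsWithin 0 (Set.Ioi 0)) (nhds (twoPointTw m θ g)) := by
  have hcD := continuous_twistedDensity hm θ
  have hcη := continuous_decayRate m η
  have hcη' := continuous_decayRate m η'
  have hcF := continuous_onShellFourier m g
  rw [twoPointTw_eq]
  refine Filter.Tendsto.congr' (f₁ := fun t : ℝ => ((((2 * Real.pi) ^ 6)⁻¹ : ℝ) : ℂ) *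
    ∫ kp : (Fin 3 → ℝ) × (Fin 3 → ℝ),
      (Real.exp (-(t * (decayRate m η kp.1 + decayRate m η' kp.2))) : ℂ) *
        (twistedDensity m θ kp * onShellFourier m g kp)) ?_ ?_
  · filter_upwards [self_mem_nhdsWithin] with t ht
    exact (integral_f₂θAna_cpt_mul hm θ hη hη' g ht).symm
  refine Filter.Tendsto.const_mul _ (tendsto_integral_filter_of_dominated_convergence
    (fun kp => (4 * m * m)⁻¹ * ‖onShellFourier m g kp‖) ?_ ?_ ?_ ?_)
  · exact .of_forall fun t => (by fun_prop : Continuous _).aestronglyMeasurable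
  · obtain ⟨δ, hδ, h⟩ := exists_mul_norm_le_decayRate m hη
    obtain ⟨δ', hδ', h'⟩ := exists_mul_norm_le_decayRate m hη'
    filter_upwards [self_mem_nhdsWithin] with t ht
    have ht : 0 < t := ht
    refine .of_forall fun kp => ?_
    have h₁ : 0 ≤ decayRate m η kp.1 := le_trans (by positivity) (h kp.1)
    have h₂ : 0 ≤ decayRate m η' kp.2 := le_trans (by positivity) (h' kp.2)
    rw [norm_mul, norm_mul, Complex.norm_real, Real.norm_of_nonneg (Real.exp_pos _).le]
    refine (mul_le_of_le_one_left (by positivity) (Real.exp_le_one_iff.2 ?_)).trans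
      (mul_le_mul_of_nonneg_right (norm_twistedDensity_le hm θ kp) (norm_nonneg _))
    exact neg_nonpos.2 (by positivity)
  · exact (integrable_onShellFourier m g).norm.const_mul _
  · refine .of_forall fun kp => ?_
    have hc : Continuous fun t : ℝ =>
        (Real.exp (-(t * (decayRate m η kp.1 + decayRate m η' kp.2))) : ℂ) *
          (twistedDensity m θ kp * onShellFourier m g kp) := by fun_prop
    simpa using (hc.tendsto 0).mono_left nhdsWithin_le_nhds
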